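/- For every preferential consequence relation E there exists a rational consequence relation extending E such that a formula is inconsistent for the extension only if it is already inconsistent for E (i.e., both relations have exactly the same set of inconsistent formulas). -/

import Mathlib

/-- Propositional formulas over a set `V` of propositional variables. -/
inductive Fm (V : Type) : Type
  | var : V → Fm V
  | fls : Fm V
  | tru : Fm V
  | neg : Fm V → Fm V
  | conj : Fm V → Fm V → Fm V
  | disj : Fm V → Fm V → Fm V
  | impl : Fm V → Fm V → Fm V
  | iff : Fm V → Fm V → Fm V

variable {V : Type}

/-- Truth value of a formula in a world (truth assignment). -/
def Fm.eval (w : V → Bool) : Fm V → Bool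
  | .var v => w v
  | .fls => false
  | .tru => true
  | .neg a => !(a.eval w)
  | .conj a b => a.eval w && b.eval w
  | .disj a b => a.eval w || b.eval w
  | .impl a b => !(a.eval w) || b.eval w
  | .iff a b => a.eval w == b.eval w

/-- A formula is valid iff it is satisfied by every world. -/
def Valid (a : Fm V) : Prop := ∀ w : V → Bool, a.eval w = true

/-- A conditional "relation": a set of conditional assertions (pairs of formulas). -/
abbrev CRel (V : Type) := Set (Fm V × Fm V)

/-- Preferential consequence relation: Reflexivity, Left Logical Equivalence,
Right Weakening, And, Or, Cautious Monotonicity. -/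
def IsPreferential (K : CRel V) : Prop :=
  (∀ a, (a, a) ∈ K) ∧
  (∀ a b c, Valid (a.iff b) → (a, c) ∈ K → (b, c) ∈ K) ∧
  (∀ a b c, Valid (a.impl b) → (c, a) ∈ K → (c, b) ∈ K) ∧
  (∀ a b c, (a, b) ∈ K → (a, c) ∈ K → (a, b.conj c) ∈ K) ∧
  (∀ a b c, (a, c) ∈ K → (b, c) ∈ K → (a.disj b, c) ∈ K) ∧
  (∀ a b c, (a, b) ∈ K → (a, c) ∈ K → (a.conj b, c) ∈ K)

/-- Rational Monotonicity: if α∧β |~/ γ and α |~/ ¬β then α |~/ γ. -/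
def RationalMonotonicity (K : CRel V) : Prop :=
  ∀ a b c, (a.conj b, c) ∉ K → (a, b.neg) ∉ K → (a, c) ∉ K

/-- A rational consequence relation is a preferential one satisfying Rational
Monotonicity. -/
def IsRational (K : CRel V) : Prop := IsPreferential K ∧ RationalMonotonicity K

/-- Disjunctive Rationality: if α |~/ γ and β |~/ γ then α∨β |~/ γ. -/
def DisjunctiveRationality (K : CRel V) : Prop :=
  ∀ a b c, (a, c) ∉ K → (b, c) ∉ K → (a.disj b, c) ∉ K

/-- Negation Rationality: if α∧γ |~/ β and α∧¬γ |~/ β then α |~/ β. -/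
def NegationRationality (K : CRel V) : Prop :=
  ∀ a b c, (a.conj c, b) ∉ K → (a.conj c.neg, b) ∉ K → (a, b) ∉ K

/-- `s` is minimal in `A` with respect to the strict order `lt`. -/
def MinIn {S : Type} (lt : S → S → Prop) (A : Set S) (s : S) : Prop :=
  s ∈ A ∧ ∀ t ∈ A, ¬ lt t s

/-- A preferential model: states, labeling by worlds, a strict partial order
satisfying the smoothness condition for each formula. -/
structure PrefModel (V : Type) where
  S : Type
  l : S → V → Bool
  lt : S → S → Prop
  irrefl : ∀ s, ¬ lt s s
  trans : ∀ s t u, lt s t → lt t u → lt s u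
  smooth : ∀ (a : Fm V) (s : S), a.eval (l s) = true →
    MinIn lt {t | a.eval (l t) = true} s ∨
    ∃ t, MinIn lt {t | a.eval (l t) = true} t ∧ lt t s

/-- The model `W` satisfies α |~ β iff every state minimal in α̂ satisfies β. -/
def PrefModel.Sat (W : PrefModel V) (a b : Fm V) : Prop :=
  ∀ s, MinIn W.lt {t | a.eval (W.l t) = true} s → b.eval (W.l s) = true

/-- The consequence relation defined by a preferential model. -/
def PrefModel.Rel (W : PrefModel V) : CRel V := {p | W.Sat p.1 p.2}

/-- `W` is a model of the knowledge base `K`. -/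
def PrefModel.Models (W : PrefModel V) (K : CRel V) : Prop := ∀ p ∈ K, W.Sat p.1 p.2

/-- Preferential entailment: `A` is satisfied by every preferential model of `K`. -/
def Entails (K : CRel V) (A : Fm V × Fm V) : Prop :=
  ∀ W : PrefModel V, W.Models K → W.Sat A.1 A.2

/-- The preferential closure of a knowledge base. -/
def PrefClosure (K : CRel V) : CRel V := {A | Entails K A}

/-- A model is well-founded iff it has no infinite descending chain of states. -/
def PrefModel.NoInfDesc (W : PrefModel V) : Prop :=
  ¬ ∃ f : ℕ → W.S, ∀ n, W.lt (f (n + 1)) (f n)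

/-- A ranked model: the strict order is given by a ranking function into a
totally ordered set. -/
def PrefModel.Ranked (W : PrefModel V) : Prop :=
  ∃ (Ω : Type) (_ : LinearOrder Ω) (r : W.S → Ω), ∀ s t, W.lt s t ↔ r s < r t

/-- α is exceptional for K iff K preferentially entails true |~ ¬α. -/
def Exceptional (K : CRel V) (a : Fm V) : Prop := Entails K (Fm.tru, a.neg)

/-- The set of assertions of K whose antecedent is exceptional for K. -/
def ESet (K : CRel V) : CRel V := {p ∈ K | Exceptional K p.1}

/-- The exceptionality hierarchy: C₀ = K, C_{τ+1} = E(C_τ), intersections at limits. -/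
noncomputable def Cseq (K : CRel V) : Ordinal.{0} → CRel V := fun τ =>
  Ordinal.limitRecOn τ K (fun _ C => ESet C)
    (fun o _ ih => ⋂ ρ : Set.Iio o, ih ρ.1 ρ.2)

/-- α has a rank for K iff it is not exceptional for some C_τ. -/
def HasRank (K : CRel V) (a : Fm V) : Prop := ∃ τ : Ordinal.{0}, ¬ Exceptional (Cseq K τ) a

/-- The rank of α for K: the least τ such that α is not exceptional for C_τ. -/
noncomputable def rnk (K : CRel V) (a : Fm V) : Ordinal.{0} :=
  sInf {τ : Ordinal.{0} | ¬ Exceptional (Cseq K τ) a}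

/-- K is admissible iff every formula with no rank is inconsistent for K. -/
def Admissible (K : CRel V) : Prop :=
  ∀ a : Fm V, ¬ HasRank K a → Entails K (a, Fm.fls)

/-- `α < β in K`: the assertion α∨β |~ ¬β belongs to K. -/
def ltIn (K : CRel V) (a b : Fm V) : Prop := (a.disj b, b.neg) ∈ K

/-- K₀ is preferable to K₁. -/
def Pref (K0 K1 : CRel V) : Prop :=
  (∃ a b, (a, b) ∈ K1 \ K0 ∧
    ∀ c, ltIn K0 c a → ∀ d, (c, d) ∈ K0 → (c, d) ∈ K1) ∧
  (∀ c d, (c, d) ∈ K0 \ K1 → ∃ r e, (r, e) ∈ K1 \ K0 ∧ ltIn K1 r c)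

/-- C is the rational closure of K: a rational extension of K preferable to
every other rational extension of K. -/
def IsRationalClosure (K C : CRel V) : Prop :=
  IsRational C ∧ K ⊆ C ∧ ∀ C', IsRational C' → K ⊆ C' → C' ≠ C → Pref C C'

/-- An assertion α |~ β is supported by K^p iff there is γ with α ⊨ γ and
γ |~ β ∈ K^p. -/
def Supported (K : CRel V) (A : Fm V × Fm V) : Prop :=
  ∃ c : Fm V, Valid (A.1.impl c) ∧ (c, A.2) ∈ PrefClosure K

/-- Classical entailment from the material counterpart of a knowledge base. -/
def MatEntails (K : CRel V) (a : Fm V) : Prop :=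
  ∀ w : V → Bool, (∀ p ∈ K, (p.1.impl p.2).eval w = true) → a.eval w = true

/-- The disjunction of the antecedents of a list of conditional assertions. -/
def antecedents : List (Fm V × Fm V) → Fm V
  | [] => .fls
  | p :: L => p.1.disj (antecedents L)

/-- The conjunction of the material counterparts of a list of conditional assertions. -/
def material : List (Fm V × Fm V) → Fm V
  | [] => .tru
  | p :: L => (p.1.impl p.2).conj (material L)

/-- A knowledge base `M` is tolerant with respect to `E` when no finite part of `M` forces
an `E`-consistent formula to become inconsistent. -/
def Tolerant (E M : CRel V) : Prop :=
  ∀ L : List (Fm V × Fm V), (∀ p ∈ L, p ∈ M) →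
    ((antecedents L).conj (material L), Fm.fls) ∈ E → (antecedents L, Fm.fls) ∈ E

theorem eval_antecedents (w : V → Bool) (L : List (Fm V × Fm V)) :
    (antecedents L).eval w = true ↔ ∃ p ∈ L, p.1.eval w = true := by
  induction L with
  | nil => simp [antecedents, Fm.eval]
  | cons p L ih => simp [antecedents, Fm.eval, ih]

theorem eval_material (w : V → Bool) (L : List (Fm V × Fm V)) :
    (material L).eval w = true ↔ ∀ p ∈ L, p.1.eval w = true → p.2.eval w = true := by
  induction L with
  | nil => simp [material, Fm.eval]
  | cons p L ih =>
    simp only [material, Fm.eval, Bool.and_eq_true, ih, List.mem_cons, forall_eq_or_imp]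
    cases p.1.eval w <;> simp

theorem eval_antecedents_conj_material (w : V → Bool) (L : List (Fm V × Fm V)) :
    ((antecedents L).conj (material L)).eval w = true ↔
      (∃ p ∈ L, p.1.eval w = true) ∧ ∀ p ∈ L, p.1.eval w = true → p.2.eval w = true := by
  simp only [Fm.eval, Bool.and_eq_true, eval_antecedents, eval_material]

namespace IsPreferential

variable {E : CRel V}

theorem left_equiv (hE : IsPreferential E) {a b c : Fm V}
    (h : ∀ w, a.eval w = b.eval w) (hac : (a, c) ∈ E) :
    (b, c) ∈ E :=
  hE.2.1 a b c (fun w => by simp [Fm.eval, h w]) hac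

theorem right_weaken (hE : IsPreferential E) {a b c : Fm V}
    (h : ∀ w, a.eval w = true → b.eval w = true)
    (hca : (c, a) ∈ E) : (c, b) ∈ E :=
  hE.2.2.1 a b c (fun w => by
    have := h w
    simp only [Fm.eval]
    cases h₁ : a.eval w <;> simp_all) hca

theorem of_imp (hE : IsPreferential E) {a b : Fm V}
    (h : ∀ w, a.eval w = true → b.eval w = true) : (a, b) ∈ E :=
  hE.right_weaken h (hE.1 a)

theorem inconsistent_mono (hE : IsPreferential E) {a b : Fm V}
    (h : ∀ w, a.eval w = true → b.eval w = true)
    (hb : (b, Fm.fls) ∈ E) : (a, Fm.fls) ∈ E := by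
  have hba : (b, a) ∈ E := hE.right_weaken (fun w hw => by simp [Fm.eval] at hw) hb
  refine hE.left_equiv (fun w => ?_) (hE.2.2.2.2.2 b a _ hba hb)
  have := h w
  simp only [Fm.eval]
  cases h₁ : a.eval w <;> simp_all

/-- Reasoning by cases on a formula `c`. -/
theorem by_cases (hE : IsPreferential E) {a b c : Fm V}
    (h₁ : (a.conj c, b) ∈ E) (h₂ : (a.conj c.neg, b) ∈ E) :
    (a, b) ∈ E := by
  refine hE.left_equiv (fun w => ?_) (hE.2.2.2.2.1 _ _ _ h₁ h₂)
  simp only [Fm.eval]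
  cases a.eval w <;> cases c.eval w <;> rfl

theorem impl_of_imp (hE : IsPreferential E) {a b c : Fm V} (h : (b, c) ∈ E)
    (hab : ∀ w, b.eval w = true → a.eval w = true) : (a, b.impl c) ∈ E := by
  refine hE.by_cases (c := b) (hE.left_equiv (a := b) (fun w => ?_)
    (hE.right_weaken (fun w hw => by simp [Fm.eval, hw]) h))
    (hE.of_imp fun w hw => ?_)
  · have := hab w
    simp only [Fm.eval]
    cases h₁ : b.eval w <;> simp_all
  · simp only [Fm.eval, Bool.and_eq_true] at hw ⊢
    simp [hw.2]

theorem material_mem (hE : IsPreferential E) {a : Fm V}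
    (L : List (Fm V × Fm V)) (hL : ∀ p ∈ L, p ∈ E)
    (ha : ∀ p ∈ L, ∀ w, p.1.eval w = true → a.eval w = true) : (a, material L) ∈ E := by
  induction L with
  | nil => exact hE.of_imp fun _ _ => rfl
  | cons p L ih =>
    simp only [List.mem_cons, forall_eq_or_imp] at hL ha
    exact hE.2.2.2.1 _ _ _ (hE.impl_of_imp hL.1 ha.1) (ih hL.2 ha.2)

theorem inconsistent_cut (hE : IsPreferential E) {a b : Fm V}
    (hab : (a, b) ∈ E) (h : (a.conj b, Fm.fls) ∈ E) :
    (a, Fm.fls) ∈ E := by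
  have hn : (a, b.neg) ∈ E := hE.by_cases (c := b)
    (hE.right_weaken (fun w hw => by simp [Fm.eval] at hw) h)
    (hE.of_imp fun w hw => by simp_all [Fm.eval])
  exact hE.right_weaken (fun w hw => by simp [Fm.eval] at hw) (hE.2.2.2.1 _ _ _ hab hn)

theorem tolerant_self (hE : IsPreferential E) : Tolerant E E := fun L hL h =>
  hE.inconsistent_cut (hE.material_mem L hL fun p hp w hw =>
    (eval_antecedents w L).2 ⟨p, hp, hw⟩) h

end IsPreferential

theorem exists_mem_append_iff {α : Type*} {P : α → Prop} (L₁ L₂ : List α) :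
    (∃ x ∈ L₁ ++ L₂, P x) ↔ (∃ x ∈ L₁, P x) ∨ ∃ x ∈ L₂, P x := by
  simp only [List.mem_append, or_and_right, exists_or]

theorem exists_mem_chain_of_list {α : Type*} {c : Set (Set α)} (hc : IsChain (· ⊆ ·) c)
    (hne : c.Nonempty) (L : List α) (hL : ∀ p ∈ L, p ∈ ⋃₀ c) :
    ∃ M ∈ c, ∀ p ∈ L, p ∈ M := by
  induction L with
  | nil => exact hne.imp fun M hM => ⟨hM, by simp⟩
  | cons p L ih =>
    simp only [List.mem_cons, forall_eq_or_imp] at hL ⊢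
    obtain ⟨M, hM, hLM⟩ := ih hL.2
    obtain ⟨N, hN, hpN⟩ := hL.1
    rcases hc.total hM hN with h | h
    · exact ⟨N, hN, hpN, fun q hq => h (hLM q hq)⟩
    · exact ⟨M, hM, h hpN, hLM⟩

theorem exists_maximal_tolerant {E : CRel V} (hE : IsPreferential E) :
    ∃ M, E ⊆ M ∧ Maximal (Tolerant E) M := by
  refine zorn_subset_nonempty {M | Tolerant E M} (fun c hcT hc hne => ?_) E hE.tolerant_self
  refine ⟨⋃₀ c, fun L hL => ?_, fun s hs => Set.subset_sUnion_of_mem hs⟩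
  obtain ⟨M, hM, hLM⟩ := exists_mem_chain_of_list hc hne L hL
  exact hcT hM L hLM

section MaximalTolerant

variable {E M : CRel V}

theorem exists_clash_of_notMem (hE : IsPreferential E)
    (hM : Maximal (Tolerant E) M) {p : Fm V × Fm V} (hp : p ∉ M) :
    ∃ L : List (Fm V × Fm V), (∀ q ∈ L, q ∈ M) ∧
      ((antecedents (p :: L)).conj (material (p :: L)), Fm.fls) ∈ E ∧
      (antecedents (p :: L), Fm.fls) ∉ E := by
  classical
  have hins : ¬ Tolerant E (insert p M) := fun h =>
    hp (hM.2 h (Set.subset_insert p M) (Set.mem_insert p M))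
  simp only [Tolerant, not_forall] at hins
  obtain ⟨L, hL, hX, hA⟩ := hins
  have hpL : p ∈ L := by
    by_contra hpL
    exact hA (hM.1 L (fun q hq => (hL q hq).resolve_left fun h => hpL (h ▸ hq)) hX)
  have hmem : ∀ q, q ∈ p :: L.filter (· ≠ p) ↔ q ∈ L := by
    intro q
    by_cases hq : q = p <;> simp_all
  refine ⟨L.filter (· ≠ p), fun q hq => ?_, hE.inconsistent_mono (fun w hw => ?_) hX,
    fun h => hA (hE.inconsistent_mono (fun w hw => ?_) h)⟩
  · simp only [List.mem_filter, decide_eq_true_eq] at hq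
    exact (hL q hq.1).resolve_left hq.2
  · rw [eval_antecedents_conj_material] at hw ⊢
    simpa only [hmem] using hw
  · rw [eval_antecedents] at hw ⊢
    simpa only [hmem] using hw

/-- A maximal tolerant knowledge base contains `p` as soon as it contains a finite list `P`
whose tolerance condition is at least as strong as that of `p`. -/
theorem mem_of_maximal_tolerant (hE : IsPreferential E)
    (hM : Maximal (Tolerant E) M) {p : Fm V × Fm V} (P : List (Fm V × Fm V))
    (hP : ∀ q ∈ P, q ∈ M)
    (hante : ∀ w, p.1.eval w = true → ∃ q ∈ P, q.1.eval w = true)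
    (hmat : ∀ w, (∀ q ∈ P, q.1.eval w = true → q.2.eval w = true) →
      (p.1.eval w = true → p.2.eval w = true) ∧
      ((∃ q ∈ P, q.1.eval w = true) → p.1.eval w = true)) : p ∈ M := by
  by_contra hp
  obtain ⟨L, hL, hX, hA⟩ := exists_clash_of_notMem hE hM hp
  refine hA (hE.inconsistent_mono (fun w hw => ?_) (hM.1 (P ++ L) ?_
    (hE.inconsistent_mono (fun w hw => ?_) hX)))
  · rw [eval_antecedents] at hw ⊢
    simp only [List.exists_mem_cons_iff, exists_mem_append_iff] at hw ⊢
    exact hw.imp_left (hante w)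
  · exact List.forall_mem_append.2 ⟨hP, hL⟩
  · rw [eval_antecedents_conj_material] at hw ⊢
    simp only [List.exists_mem_cons_iff, exists_mem_append_iff, List.forall_mem_cons,
      List.forall_mem_append] at hw ⊢
    obtain ⟨h₁, h₂, h₃⟩ := hw
    exact ⟨h₁.imp_left (hmat w h₂).2, (hmat w h₂).1, h₃⟩

theorem isPreferential_of_maximal_tolerant (hE : IsPreferential E)
    (hM : Maximal (Tolerant E) M) (hEM : E ⊆ M) : IsPreferential M := by
  refine ⟨fun a => hEM (hE.1 a), fun a b c hv h => ?_, fun a b c hv h => ?_,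
    fun a b c h₁ h₂ => ?_, fun a b c h₁ h₂ => ?_, fun a b c h₁ h₂ => ?_⟩
  · refine mem_of_maximal_tolerant hE hM [(a, c)] (by simpa using h) (fun w => ?_) (fun w => ?_)
    all_goals
      have := hv w
      simp_all [Fm.eval]
  · refine mem_of_maximal_tolerant hE hM [(c, a)] (by simpa using h) (fun w => ?_) (fun w => ?_)
    all_goals
      have := hv w
      cases h₁ : c.eval w <;> cases h₂ : a.eval w <;> simp_all [Fm.eval]
  all_goals
    refine mem_of_maximal_tolerant hE hM [(_, _), (_, _)]
      (List.forall_mem_cons.2 ⟨h₁, List.forall_mem_singleton.2 h₂⟩)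
      (fun w => ?_) (fun w => ?_)
    all_goals
      cases h₁ : a.eval w <;> cases h₂ : b.eval w <;> cases h₃ : c.eval w <;>
        simp_all [Fm.eval]

theorem rationalMonotonicity_of_maximal_tolerant (hE : IsPreferential E)
    (hM : Maximal (Tolerant E) M) : RationalMonotonicity M := by
  intro a b c h₁ h₂ h
  obtain ⟨S, hS, hXS, -⟩ := exists_clash_of_notMem hE hM h₁
  obtain ⟨T, hT, hXT, hAT⟩ := exists_clash_of_notMem hE hM h₂
  refine hAT (hE.inconsistent_mono (fun w hw => ?_) (hM.1 ((a, c) :: (S ++ T)) ?_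
    (hE.inconsistent_mono (fun w hw => ?_) (hE.2.2.2.2.1 _ _ _ hXS hXT))))
  · rw [eval_antecedents] at hw ⊢
    simp only [List.exists_mem_cons_iff, exists_mem_append_iff] at hw ⊢
    exact hw.imp_right Or.inr
  · exact List.forall_mem_cons.2 ⟨h, List.forall_mem_append.2 ⟨hS, hT⟩⟩
  · rw [Fm.eval, Bool.or_eq_true]
    rw [eval_antecedents_conj_material] at hw ⊢
    rw [eval_antecedents_conj_material]
    simp only [List.exists_mem_cons_iff, exists_mem_append_iff, List.forall_mem_cons,
      List.forall_mem_append] at hw ⊢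
    obtain ⟨hA, hac, hCS, hCT⟩ := hw
    simp only [Fm.eval, Bool.and_eq_true, Bool.not_eq_true', ← Bool.not_eq_true]
    by_cases ha : a.eval w = true
    · by_cases hb : b.eval w = true
      · exact Or.inl ⟨Or.inl ⟨ha, hb⟩, fun _ => hac ha, hCS⟩
      · exact Or.inr ⟨Or.inl ha, fun _ => hb, hCT⟩
    · rcases hA.resolve_left ha with h | h
      · exact Or.inl ⟨Or.inr h, fun h => absurd h.1 ha, hCS⟩
      · exact Or.inr ⟨Or.inr h, fun h => absurd h ha, hCT⟩

end MaximalTolerant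

/-- Every preferential relation has a rational extension with exactly the same
inconsistent formulas. -/
theorem stmt12 (V : Type) (E : CRel V) (hE : IsPreferential E) :
    ∃ R : CRel V, IsRational R ∧ E ⊆ R ∧
      ∀ a : Fm V, (a, Fm.fls) ∈ R ↔ (a, Fm.fls) ∈ E := by
  obtain ⟨M, hEM, hM⟩ := exists_maximal_tolerant hE
  refine ⟨M, ⟨isPreferential_of_maximal_tolerant hE hM hEM,
    rationalMonotonicity_of_maximal_tolerant hE hM⟩, hEM, fun a => ⟨fun h => ?_, fun h => hEM h⟩⟩
  refine hE.inconsistent_mono (fun w hw => ?_) (hM.1 [(a, Fm.fls)] (by simpa using h)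
    (hE.of_imp fun w hw => ?_))
  · simpa [eval_antecedents] using hw
  · rw [eval_antecedents_conj_material] at hw
    simp_all
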